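/- arXiv:1811.06909 — 4 statements merged into one kernel-verified Lean document; each statement's English description precedes it below -/
import Mathlib

section
/- Let $F(y,z)=(\Theta(y),R(y,z))$ be a non-degenerate fibered map of degree $d\ge2$ on $\mathbb{C}^{r+1}\times\mathbb{C}^q$. Then there exists $\epsilon_0\in(0,1]$ such that for every $\epsilon\in(0,\epsilon_0]$ and every $(y,z)\in\mathbb{C}^{r+1}\times\mathbb{C}^q$ with $\|y\|_\infty\le\epsilon\|z\|_\infty$ one has $\|\Theta(y)\|_\infty\le(\epsilon/2)\,\|R(y,z)\|_\infty$. (Equivalently, the induced endomorphism $f$ of $\mathbb{P}^k$ maps the closure of the region $U_\epsilon=\{[y:z]\in\mathbb{P}^k : \|y\|_\infty<\epsilon\|z\|_\infty\}$ into the closure of $U_{\epsilon/2}$.) -/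
/-- A fibered map of degree `d` on `ℂ^{r+1} × ℂ^q` is a pair `(Θ, R)` where every
coordinate of `Θ : ℂ^{r+1} → ℂ^{r+1}` and of `R : ℂ^{r+1} × ℂ^q → ℂ^q` is a homogeneous
polynomial of degree `d` in the variables `(y, z)`, with `Θ` depending only on `y`. -/
def IsFiberedMap (r q d : ℕ) (Θ : (Fin (r + 1) → ℂ) → (Fin (r + 1) → ℂ))
    (R : (Fin (r + 1) → ℂ) → (Fin q → ℂ) → (Fin q → ℂ)) : Prop :=
  (∃ pΘ : Fin (r + 1) → MvPolynomial (Fin (r + 1)) ℂ,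
      (∀ i, (pΘ i).IsHomogeneous d) ∧ ∀ y i, Θ y i = MvPolynomial.eval y (pΘ i)) ∧
  (∃ pR : Fin q → MvPolynomial (Fin (r + 1) ⊕ Fin q) ℂ,
      (∀ i, (pR i).IsHomogeneous d) ∧
        ∀ y z i, R y z i = MvPolynomial.eval (Sum.elim y z) (pR i))

theorem MvPolynomial.IsHomogeneous.eval_smul_eq {σ A : Type*} [CommSemiring A]
    {p : MvPolynomial σ A} {d : ℕ} (hp : p.IsHomogeneous d) (c : A) (x : σ → A) :
    MvPolynomial.eval (c • x) p = c ^ d * MvPolynomial.eval x p := by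
  rw [MvPolynomial.eval_eq, MvPolynomial.eval_eq, Finset.mul_sum]
  refine Finset.sum_congr rfl fun s hs => ?_
  simp only [Pi.smul_apply, smul_eq_mul, mul_pow, Finset.prod_mul_distrib,
    Finset.prod_pow_eq_pow_sum, ← hp.degree_eq_sum_deg_support hs]
  ring

section HomogeneousMaps

variable {E F : Type*} [NormedAddCommGroup E] [NormedSpace ℂ E] [NormedAddCommGroup F]
  [NormedSpace ℂ F] {G : E → F} {d : ℕ}

theorem norm_eq_norm_pow_mul_of_homogeneous (hG : ∀ (c : ℂ) x, G (c • x) = c ^ d • G x)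
    {x : E} (hx : x ≠ 0) :
    ∃ u ∈ Metric.sphere (0 : E) 1, ‖G x‖ = ‖x‖ ^ d * ‖G u‖ := by
  have hx' : ‖x‖ ≠ 0 := norm_ne_zero_iff.mpr hx
  refine ⟨((‖x‖ : ℂ)⁻¹) • x, ?_, ?_⟩
  · simp [norm_smul, hx']
  · rw [hG, norm_smul]
    simp [hx']

variable [ProperSpace E]

theorem exists_norm_le_mul_norm_pow_of_homogeneous (hc : Continuous G) (hd : d ≠ 0)
    (hG : ∀ (c : ℂ) x, G (c • x) = c ^ d • G x) :
    ∃ C : ℝ, 0 < C ∧ ∀ x, ‖G x‖ ≤ C * ‖x‖ ^ d := by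
  obtain ⟨C, hC⟩ := (isCompact_sphere (0 : E) 1).exists_bound_of_continuousOn hc.continuousOn
  refine ⟨max C 1, by positivity, fun x => ?_⟩
  by_cases hx : x = 0
  · have h0 : G 0 = 0 := by simpa [hd] using hG 0 0
    simp [hx, h0, hd]
  · obtain ⟨u, hu, h⟩ := norm_eq_norm_pow_mul_of_homogeneous hG hx
    rw [h, mul_comm]
    gcongr
    exact (hC u hu).trans (le_max_left _ _)

theorem exists_mul_norm_pow_le_norm_of_homogeneous (hc : Continuous G) (hd : d ≠ 0)
    (hG : ∀ (c : ℂ) x, G (c • x) = c ^ d • G x) (hnd : ∀ x, G x = 0 → x = 0) :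
    ∃ c : ℝ, 0 < c ∧ ∀ x, c * ‖x‖ ^ d ≤ ‖G x‖ := by
  obtain ⟨c, hc0, hc⟩ := (isCompact_sphere (0 : E) 1).exists_forall_le'
    (f := fun x => ‖G x‖) (a := 0) hc.norm.continuousOn fun x hx =>
      norm_pos_iff.mpr fun h => ne_zero_of_mem_unit_sphere ⟨x, hx⟩ (hnd x h)
  refine ⟨c, hc0, fun x => ?_⟩
  by_cases hx : x = 0
  · simp [hx, hd]
  · obtain ⟨u, hu, h⟩ := norm_eq_norm_pow_mul_of_homogeneous hG hx
    rw [h, mul_comm]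
    gcongr
    exact hc u hu

end HomogeneousMaps

/-- for a non-degenerate fibered map `F(y,z) = (Θ(y), R(y,z))` of degree
`d ≥ 2`, there is `ε₀ ∈ (0,1]` such that for every `ε ∈ (0,ε₀]` and every `(y,z)` with
`‖y‖ ≤ ε‖z‖` one has `‖Θ(y)‖ ≤ (ε/2)‖R(y,z)‖`; i.e. the induced endomorphism of `ℙ^k`
maps the closure of `U_ε` into the closure of `U_{ε/2}`. -/
theorem stmt3 (r q d : ℕ) (hd : 2 ≤ d)
    (Θ : (Fin (r + 1) → ℂ) → (Fin (r + 1) → ℂ))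
    (R : (Fin (r + 1) → ℂ) → (Fin q → ℂ) → (Fin q → ℂ))
    (hfib : IsFiberedMap r q d Θ R)
    (hnd : ∀ y z, Θ y = 0 → R y z = 0 → y = 0 ∧ z = 0) :
    ∃ ε₀ : ℝ, 0 < ε₀ ∧ ε₀ ≤ 1 ∧
      ∀ ε : ℝ, 0 < ε → ε ≤ ε₀ →
        ∀ (y : Fin (r + 1) → ℂ) (z : Fin q → ℂ), ‖y‖ ≤ ε * ‖z‖ →
          ‖Θ y‖ ≤ (ε / 2) * ‖R y z‖ := by
  obtain ⟨⟨pΘ, hpΘ, hΘ⟩, pR, hpR, hR⟩ := hfib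
  have hd0 : d ≠ 0 := by omega
  have hΘc : Continuous Θ := continuous_pi fun i => by
    simpa only [hΘ] using (pΘ i).continuous_eval
  have hΘs : ∀ (c : ℂ) y, Θ (c • y) = c ^ d • Θ y := fun c y => by
    ext i
    simp [hΘ, (hpΘ i).eval_smul_eq]
  have hRc : Continuous fun x : (Fin (r + 1) → ℂ) × (Fin q → ℂ) => R x.1 x.2 :=
    continuous_pi fun i => by
      simp only [hR]
      refine (pR i).continuous_eval.comp (continuous_pi fun j => ?_)
      cases j <;> simp only [Sum.elim_inl, Sum.elim_inr] <;> fun_prop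
  have hRs : ∀ (c : ℂ) y z, R (c • y) (c • z) = c ^ d • R y z := fun c y z => by
    ext i
    have h : Sum.elim (c • y) (c • z) = c • Sum.elim y z := by
      ext j
      cases j <;> rfl
    simp [hR, h, (hpR i).eval_smul_eq]
  obtain ⟨C, hC0, hC⟩ := exists_norm_le_mul_norm_pow_of_homogeneous hΘc hd0 hΘs
  obtain ⟨c, hc0, hc⟩ := exists_mul_norm_pow_le_norm_of_homogeneous
    (G := fun x : (Fin (r + 1) → ℂ) × (Fin q → ℂ) => (Θ x.1, R x.1 x.2))
    ((hΘc.comp continuous_fst).prodMk hRc) hd0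
    (fun a x => by simp [hΘs, hRs])
    (fun x hx => Prod.ext_iff.mpr
      (hnd x.1 x.2 (congrArg Prod.fst hx) (congrArg Prod.snd hx)))
  refine ⟨min 1 (c / (2 * C)), by positivity, min_le_left _ _, fun ε hε hε₀ y z hyz => ?_⟩
  have hε1 : ε ≤ 1 := hε₀.trans (min_le_left _ _)
  have hεC : ε * (2 * C) ≤ c := (le_div_iff₀ (by positivity)).mp (hε₀.trans (min_le_right _ _))
  have hΘle : ‖Θ y‖ ≤ ε / 2 * (c * ‖z‖ ^ d) :=
    calc ‖Θ y‖ ≤ C * ‖y‖ ^ d := hC y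
      _ ≤ C * (ε * ‖z‖) ^ d := by gcongr
      _ = C * ε ^ d * ‖z‖ ^ d := by ring
      _ ≤ C * ε ^ 2 * ‖z‖ ^ d := by
        have := pow_le_pow_of_le_one hε.le hε1 hd
        gcongr
      _ = ε / 2 * (ε * (2 * C) * ‖z‖ ^ d) := by ring
      _ ≤ ε / 2 * (c * ‖z‖ ^ d) := by gcongr
  have hmax : c * ‖z‖ ^ d ≤ max ‖Θ y‖ ‖R y z‖ :=
    calc c * ‖z‖ ^ d ≤ c * ‖(y, z)‖ ^ d := by
          gcongr
          exact norm_snd_le (y, z)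
      _ ≤ max ‖Θ y‖ ‖R y z‖ := hc (y, z)
  have hcz : c * ‖z‖ ^ d ≤ ‖R y z‖ := by
    rcases le_max_iff.mp hmax with h | h
    · have h0 : 0 ≤ c * ‖z‖ ^ d := by positivity
      exact le_trans (by nlinarith) (norm_nonneg (R y z))
    · exact h
  exact hΘle.trans (by gcongr)
end

section
/- Let $F(y,z)=(\Theta(y),R(y,z))$ be a non-degenerate fibered map of degree $d\ge2$ on $\mathbb{C}^{r+1}\times\mathbb{C}^q$. Then there exists $\epsilon_0\in(0,1]$ such that for every $\epsilon\in(0,\epsilon_0]$, every integer $n\ge0$ and every nonzero $(y,z)$ with $\|y\|_\infty\le\epsilon\|z\|_\infty$, writing $F^n(y,z)=(Y_n,Z_n)$ one has $\|Y_n\|_\infty\le2^{-n}\epsilon\,\|Z_n\|_\infty$. (Consequently $\bigcap_{n\ge1}f^n(\overline{U_\epsilon})$ is contained in the indeterminacy set $I(\pi)=\{y=0\}$ of the standard linear fibration.) -/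
/-- Evaluating a homogeneous polynomial at a rescaled point. -/
theorem MvPolynomial.IsHomogeneous.eval_smul {σ K : Type*} [CommSemiring K] {d : ℕ}
    {p : MvPolynomial σ K} (hp : p.IsHomogeneous d) (a : K) (x : σ → K) :
    MvPolynomial.eval (a • x) p = a ^ d * MvPolynomial.eval x p := by
  rw [MvPolynomial.eval_eq, MvPolynomial.eval_eq, Finset.mul_sum]
  refine Finset.sum_congr rfl fun m hm => ?_
  have hdeg : m.degree = d := by
    rw [Finsupp.degree_eq_weight_one]
    exact hp (MvPolynomial.mem_support_iff.mp hm)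
  simp only [Pi.smul_apply, smul_eq_mul, mul_pow, Finset.prod_mul_distrib,
    Finset.prod_pow_eq_pow_sum]
  rw [← hdeg, Finsupp.degree_apply]
  ring

/-- Every nonzero vector is a scalar multiple, by its norm, of a unit vector. -/
theorem exists_unit_smul_eq {E : Type*} [NormedAddCommGroup E] [NormedSpace ℂ E]
    {x : E} (hx : x ≠ 0) :
    ∃ u : E, ‖u‖ = 1 ∧ ((‖x‖ : ℝ) : ℂ) • u = x := by
  have h : ((‖x‖ : ℝ) : ℂ) ≠ 0 := by simpa using hx
  refine ⟨((‖x‖ : ℝ) : ℂ)⁻¹ • x, ?_, smul_inv_smul₀ h x⟩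
  rw [norm_smul, norm_inv, Complex.norm_real, norm_norm]
  exact inv_mul_cancel₀ (norm_ne_zero_iff.mpr hx)

section Homogeneous

variable {E G : Type*} [NormedAddCommGroup E] [NormedSpace ℂ E] [ProperSpace E]
  [NormedAddCommGroup G] [NormedSpace ℂ G] {d : ℕ} {f : E → G}

/-- A continuous homogeneous map grows at most like the corresponding power of the norm. -/
theorem exists_norm_le_mul_pow_of_homogeneous (hd : d ≠ 0) (hf : Continuous f)
    (hom : ∀ (a : ℂ) x, f (a • x) = a ^ d • f x) :
    ∃ C : ℝ, ∀ x, ‖f x‖ ≤ C * ‖x‖ ^ d := by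
  obtain ⟨C, hC⟩ := (isCompact_sphere (0 : E) 1).exists_bound_of_continuousOn hf.continuousOn
  refine ⟨C, fun x => ?_⟩
  rcases eq_or_ne x 0 with rfl | hx
  · have h0 : f 0 = 0 := by simpa [hd] using hom 0 0
    simp [h0, hd]
  · obtain ⟨u, hu, hux⟩ := exists_unit_smul_eq hx
    have hfx : ‖f x‖ = ‖x‖ ^ d * ‖f u‖ := by
      rw [← congrArg f hux, hom, norm_smul, norm_pow, Complex.norm_real, norm_norm]
    rw [hfx, mul_comm]
    gcongr
    exact hC u (by simpa using hu)

/-- A continuous homogeneous map vanishing only at the origin grows at least like the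
corresponding power of the norm. -/
theorem exists_mul_pow_le_norm_of_homogeneous (hd : d ≠ 0) (hf : Continuous f)
    (hom : ∀ (a : ℂ) x, f (a • x) = a ^ d • f x) (hnd : ∀ x, f x = 0 → x = 0) :
    ∃ c : ℝ, 0 < c ∧ ∀ x, c * ‖x‖ ^ d ≤ ‖f x‖ := by
  obtain ⟨c, hc, hcf⟩ := (isCompact_sphere (0 : E) 1).exists_forall_le' (f := fun x => ‖f x‖)
    (a := 0) hf.norm.continuousOn fun u hu => norm_pos_iff.mpr fun h => by
      simp [hnd u h] at hu
  refine ⟨c, hc, fun x => ?_⟩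
  rcases eq_or_ne x 0 with rfl | hx
  · simp [hd]
  · obtain ⟨u, hu, hux⟩ := exists_unit_smul_eq hx
    have hfx : ‖f x‖ = ‖x‖ ^ d * ‖f u‖ := by
      rw [← congrArg f hux, hom, norm_smul, norm_pow, Complex.norm_real, norm_norm]
    rw [hfx, mul_comm]
    gcongr
    exact hcf u (by simpa using hu)

end Homogeneous

/-- for a non-degenerate fibered map `F(y,z) = (Θ(y), R(y,z))` of degree
`d ≥ 2`, there is `ε₀ ∈ (0,1]` such that for all `ε ∈ (0,ε₀]`, all `n ≥ 0` and all
nonzero `(y,z)` with `‖y‖ ≤ ε‖z‖`, writing `F^n(y,z) = (Y_n, Z_n)` one has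
`‖Y_n‖ ≤ 2^{-n} ε ‖Z_n‖`. -/
theorem stmt4 (r q d : ℕ) (hd : 2 ≤ d)
    (Θ : (Fin (r + 1) → ℂ) → (Fin (r + 1) → ℂ))
    (R : (Fin (r + 1) → ℂ) → (Fin q → ℂ) → (Fin q → ℂ))
    (hfib : IsFiberedMap r q d Θ R)
    (hnd : ∀ y z, Θ y = 0 → R y z = 0 → y = 0 ∧ z = 0)
    (F : (Fin (r + 1) → ℂ) × (Fin q → ℂ) → (Fin (r + 1) → ℂ) × (Fin q → ℂ))
    (hF : ∀ y z, F (y, z) = (Θ y, R y z)) :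
    ∃ ε₀ : ℝ, 0 < ε₀ ∧ ε₀ ≤ 1 ∧
      ∀ ε : ℝ, 0 < ε → ε ≤ ε₀ → ∀ n : ℕ,
        ∀ (y : Fin (r + 1) → ℂ) (z : Fin q → ℂ), (y, z) ≠ 0 → ‖y‖ ≤ ε * ‖z‖ →
          ‖(F^[n] (y, z)).1‖ ≤ ε / 2 ^ n * ‖(F^[n] (y, z)).2‖ := by
  obtain ⟨⟨pΘ, hpΘ, hΘ⟩, pR, hpR, hR⟩ := hfib
  have hd0 : d ≠ 0 := by omega
  have hΘc : Continuous Θ := continuous_pi fun i => by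
    simpa only [hΘ] using MvPolynomial.continuous_eval (pΘ i)
  have hRc : Continuous fun x : (Fin (r + 1) → ℂ) × (Fin q → ℂ) => R x.1 x.2 :=
    continuous_pi fun i => by
      simp only [hR]
      refine (MvPolynomial.continuous_eval (pR i)).comp (continuous_pi fun j => ?_)
      rcases j with j | j <;> simp only [Sum.elim_inl, Sum.elim_inr] <;> fun_prop
  have hΘs : ∀ (a : ℂ) y, Θ (a • y) = a ^ d • Θ y := fun a y => by
    ext i
    simp [hΘ, (hpΘ i).eval_smul]
  have hRs : ∀ (a : ℂ) y z, R (a • y) (a • z) = a ^ d • R y z := fun a y z => by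
    ext i
    have h : Sum.elim (a • y) (a • z) = a • Sum.elim y z := by
      ext j
      rcases j with j | j <;> rfl
    simp [hR, h, (hpR i).eval_smul]
  have hFeq : F = fun x => (Θ x.1, R x.1 x.2) := funext fun x => hF x.1 x.2
  obtain ⟨A, hA⟩ := exists_norm_le_mul_pow_of_homogeneous hd0 hΘc hΘs
  obtain ⟨c, hc, hcF⟩ := exists_mul_pow_le_norm_of_homogeneous (f := F) hd0
    (by rw [hFeq]; exact (hΘc.comp continuous_fst).prodMk hRc)
    (fun a x => by simp only [hFeq, Prod.smul_fst, Prod.smul_snd, hΘs, hRs, Prod.smul_mk])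
    (fun x hx => by
      rw [hFeq, Prod.mk_eq_zero] at hx
      exact Prod.ext_iff.mpr (hnd x.1 x.2 hx.1 hx.2))
  set B : ℝ := max A 1
  have hB1 : 1 ≤ B := le_max_right _ _
  have step : ∀ t : ℝ, 0 ≤ t → t ≤ 1 → B * t ≤ c / 2 → ∀ x, ‖x.1‖ ≤ t * ‖x.2‖ →
      ‖(F x).1‖ ≤ t / 2 * ‖(F x).2‖ := by
    intro t ht0 ht1 htc x hx
    have hxn : ‖x‖ = ‖x.2‖ := by
      rw [Prod.norm_def]
      exact max_eq_right (hx.trans (mul_le_of_le_one_left (norm_nonneg _) ht1))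
    have hup : ‖(F x).1‖ ≤ t / 2 * (c * ‖x.2‖ ^ d) := by
      have htd : t ^ d ≤ t * t := by
        rw [← sq]
        exact pow_le_pow_of_le_one ht0 ht1 hd
      calc ‖(F x).1‖ = ‖Θ x.1‖ := by rw [hFeq]
        _ ≤ A * ‖x.1‖ ^ d := hA _
        _ ≤ B * (t * ‖x.2‖) ^ d := by
          gcongr
          exact le_max_left _ _
        _ = B * t ^ d * ‖x.2‖ ^ d := by rw [mul_pow, mul_assoc]
        _ ≤ B * (t * t) * ‖x.2‖ ^ d := by gcongr
        _ = t * (B * t) * ‖x.2‖ ^ d := by ring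
        _ ≤ t * (c / 2) * ‖x.2‖ ^ d := by gcongr
        _ = t / 2 * (c * ‖x.2‖ ^ d) := by ring
    have hlow : c * ‖x.2‖ ^ d ≤ max ‖(F x).1‖ ‖(F x).2‖ := by
      rw [← hxn, ← Prod.norm_def]
      exact hcF x
    have hpos : 0 ≤ c * ‖x.2‖ ^ d := by positivity
    rcases le_max_iff.mp hlow with h | h
    · have hz : c * ‖x.2‖ ^ d = 0 := by nlinarith
      rw [hz, mul_zero] at hup
      exact hup.trans (by positivity)
    · exact hup.trans (by gcongr)
  refine ⟨min 1 (c / 2 / B), by positivity, min_le_left _ _, ?_⟩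
  intro ε hε hε0 n y z _ hyz
  have hε1 : ε ≤ 1 := hε0.trans (min_le_left _ _)
  have hεc : B * ε ≤ c / 2 := by
    rw [mul_comm, ← le_div_iff₀ (by positivity)]
    exact hε0.trans (min_le_right _ _)
  induction n with
  | zero => simpa using hyz
  | succ n ih =>
    have hle : ε / 2 ^ n ≤ ε := div_le_self hε.le (one_le_pow₀ one_le_two)
    rw [Function.iterate_succ_apply', pow_succ, ← div_div]
    exact step _ (by positivity) (hle.trans hε1)
      ((mul_le_mul_of_nonneg_left hle (by positivity)).trans hεc) _ ih
end

section
/- Let $F(y,z)=(\Theta(y),R(y,z))$ be a non-degenerate fibered map of degree $d\ge2$ on $\mathbb{C}^{r+1}\times\mathbb{C}^q$ with $\Theta$ non-degenerate, and let $G(y,z)=G_F(y,z)-G_\Theta(y)$ be the relative Green function. Then on the unit sphere $S=\{(y,z) : \|(y,z)\|_\infty=1\}$ the function $G$ is continuous on $S\cap\{y\ne0\}$, and $G$ tends to $+\infty$ at $\{y=0\}$: for every $A>0$ there exists $\delta>0$ such that $(y,z)\in S$ and $0<\|y\|_\infty<\delta$ imply $G(y,z)\ge A$. (This expresses that $G$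 is continuous on $\mathbb{P}^k\setminus I(\pi)$ and $\{G=+\infty\}=I(\pi)$.) -/
/-- A homogeneous polynomial of degree `n` is a homogeneous function of degree `n`. -/
theorem MvPolynomial.IsHomogeneous.eval_const_smul {σ R : Type*} [CommSemiring R]
    {φ : MvPolynomial σ R} {n : ℕ} (hφ : φ.IsHomogeneous n) (c : R) (x : σ → R) :
    MvPolynomial.eval (c • x) φ = c ^ n * MvPolynomial.eval x φ := by
  rw [MvPolynomial.eval_eq, MvPolynomial.eval_eq, Finset.mul_sum]
  refine Finset.sum_congr rfl fun s hs => ?_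
  have hs' : ∑ i ∈ s.support, s i = n := by
    have := hφ (MvPolynomial.mem_support_iff.mp hs)
    simpa [Finsupp.weight_apply, Finsupp.sum] using this
  simp only [Pi.smul_apply, smul_eq_mul, mul_pow, Finset.prod_mul_distrib]
  rw [Finset.prod_pow_eq_pow_sum, hs']
  ring

/-- Iterates of a non-degenerate map do not vanish off the origin. -/
theorem iterate_ne_zero_of_nondegenerate {E : Type*} [Zero E] {f : E → E}
    (hnd : ∀ x, f x = 0 → x = 0) (n : ℕ) {x : E} (hx : x ≠ 0) : f^[n] x ≠ 0 := by
  induction n with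
  | zero => exact hx
  | succ n ih =>
    rw [Function.iterate_succ_apply']
    exact fun h => ih (hnd _ h)

section Green

open Filter Topology

variable {E : Type*} [NormedAddCommGroup E] [NormedSpace ℂ E]

/-- A non-degenerate continuous homogeneous map of degree `d` multiplies `log ‖x‖` by `d`,
up to a bounded error. -/
theorem exists_abs_log_norm_sub_le [ProperSpace E] {d : ℕ} {f : E → E} (hf : Continuous f)
    (hhom : ∀ (c : ℂ) x, f (c • x) = c ^ d • f x) (hnd : ∀ x, f x = 0 → x = 0) :
    ∃ C : ℝ, ∀ x, x ≠ 0 → |Real.log ‖f x‖ - d * Real.log ‖x‖| ≤ C := by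
  have hcont : ContinuousOn (fun x => Real.log ‖f x‖) (Metric.sphere (0 : E) 1) := by
    refine hf.norm.continuousOn.log fun x hx h => ?_
    have := hnd x (norm_eq_zero.mp h)
    simp [this] at hx
  obtain ⟨C, hC⟩ := (isCompact_sphere (0 : E) 1).exists_bound_of_continuousOn hcont
  refine ⟨C, fun x hx => ?_⟩
  have hx' : ‖x‖ ≠ 0 := norm_ne_zero_iff.mpr hx
  set u : E := ((‖x‖⁻¹ : ℝ) : ℂ) • x with hu
  have hu1 : ‖u‖ = 1 := by
    rw [hu, norm_smul, Complex.norm_real, norm_inv, norm_norm, inv_mul_cancel₀ hx']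
  have hxu : x = ((‖x‖ : ℝ) : ℂ) • u := by
    rw [hu, smul_smul, ← Complex.ofReal_mul, mul_inv_cancel₀ hx', Complex.ofReal_one, one_smul]
  have hfu : ‖f u‖ ≠ 0 := fun h => by
    simp [hnd u (norm_eq_zero.mp h)] at hu1
  have key : Real.log ‖f x‖ = d * Real.log ‖x‖ + Real.log ‖f u‖ := by
    conv_lhs => rw [hxu, hhom, norm_smul, norm_pow, Complex.norm_real, norm_norm]
    rw [Real.log_mul (pow_ne_zero _ hx') hfu, Real.log_pow]
  rw [key, add_sub_cancel_left]
  exact hC u (by simpa using hu1)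

/-- The sequence defining the Green function converges at a geometric rate, uniformly on the
complement of the origin. -/
theorem exists_dist_green_le [ProperSpace E] {d : ℕ} (hd : 2 ≤ d) {f : E → E}
    (hf : Continuous f) (hhom : ∀ (c : ℂ) x, f (c • x) = c ^ d • f x)
    (hnd : ∀ x, f x = 0 → x = 0) {g : E → ℝ}
    (hg : ∀ x, x ≠ 0 →
      Tendsto (fun n : ℕ => Real.log ‖f^[n] x‖ / (d : ℝ) ^ n) atTop (𝓝 (g x))) :
    ∃ C : ℝ, ∀ x, x ≠ 0 → ∀ n : ℕ, dist (Real.log ‖f^[n] x‖ / (d : ℝ) ^ n) (g x) ≤ C / 2 ^ n := by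
  obtain ⟨C, hC⟩ := exists_abs_log_norm_sub_le hf hhom hnd
  have hd2 : (2 : ℝ) ≤ d := by exact_mod_cast hd
  have hd0 : (0 : ℝ) < d := by linarith
  refine ⟨C, fun x hx => dist_le_of_le_geometric_two_of_tendsto (fun n => ?_) (hg x hx)⟩
  have hn := hC _ (iterate_ne_zero_of_nondegenerate hnd n hx)
  have hC0 : 0 ≤ C := (abs_nonneg _).trans hn
  rw [dist_comm, Real.dist_eq, Function.iterate_succ_apply']
  have hsplit : Real.log ‖f (f^[n] x)‖ / (d : ℝ) ^ (n + 1) - Real.log ‖f^[n] x‖ / (d : ℝ) ^ n =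
      (Real.log ‖f (f^[n] x)‖ - d * Real.log ‖f^[n] x‖) / (d : ℝ) ^ (n + 1) := by
    field_simp
    ring
  rw [hsplit, abs_div, abs_of_pos (pow_pos hd0 (n + 1))]
  calc _ ≤ C / (d : ℝ) ^ (n + 1) := by gcongr
    _ ≤ C / 2 ^ (n + 1) := by gcongr
    _ = C / 2 / 2 ^ n := by rw [pow_succ', div_div]

/-- The Green function is continuous off the origin and differs from `log ‖x‖` by a bounded
amount. -/
theorem continuousOn_green_and_exists_bound [ProperSpace E] {d : ℕ} (hd : 2 ≤ d) {f : E → E}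
    (hf : Continuous f) (hhom : ∀ (c : ℂ) x, f (c • x) = c ^ d • f x)
    (hnd : ∀ x, f x = 0 → x = 0) {g : E → ℝ}
    (hg : ∀ x, x ≠ 0 →
      Tendsto (fun n : ℕ => Real.log ‖f^[n] x‖ / (d : ℝ) ^ n) atTop (𝓝 (g x))) :
    ContinuousOn g {x | x ≠ 0} ∧ ∃ C : ℝ, ∀ x, x ≠ 0 → |Real.log ‖x‖ - g x| ≤ C := by
  obtain ⟨C, hC⟩ := exists_dist_green_le hd hf hhom hnd hg
  refine ⟨?_, C, fun x hx => by simpa [Real.dist_eq] using hC x hx 0⟩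
  have hunif : TendstoUniformlyOn (fun (n : ℕ) x => Real.log ‖f^[n] x‖ / (d : ℝ) ^ n) g atTop
      {x | x ≠ 0} := by
    rw [Metric.tendstoUniformlyOn_iff]
    intro ε hε
    have hlim : Tendsto (fun n : ℕ => C / 2 ^ n) atTop (𝓝 0) :=
      tendsto_const_nhds.div_atTop (tendsto_pow_atTop_atTop_of_one_lt one_lt_two)
    filter_upwards [hlim.eventually_lt_const hε] with n hn x hx
    rw [dist_comm]
    exact (hC x hx n).trans_lt hn
  refine hunif.continuousOn (Frequently.of_forall fun n => ?_)
  exact ((hf.iterate n).norm.continuousOn.log fun x hx =>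
    norm_ne_zero_iff.mpr (iterate_ne_zero_of_nondegenerate hnd n hx)).div_const _

end Green

/-- for a non-degenerate fibered map `F(y,z) = (Θ(y), R(y,z))` of degree
`d ≥ 2` with `Θ` non-degenerate, the relative Green function
`G(y,z) = G_F(y,z) - G_Θ(y)` is continuous on the part of the unit sphere where `y ≠ 0`,
and tends to `+∞` at `{y = 0}`: for every `A > 0` there is `δ > 0` such that `G ≥ A` on
the points of the sphere with `0 < ‖y‖ < δ`.  (The norm on the product is the sup norm
`‖(y,z)‖ = max(‖y‖,‖z‖)`.) -/
theorem stmt10 (r q d : ℕ) (hd : 2 ≤ d)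
    (Θ : (Fin (r + 1) → ℂ) → (Fin (r + 1) → ℂ))
    (R : (Fin (r + 1) → ℂ) → (Fin q → ℂ) → (Fin q → ℂ))
    (hfib : IsFiberedMap r q d Θ R)
    (F : (Fin (r + 1) → ℂ) × (Fin q → ℂ) → (Fin (r + 1) → ℂ) × (Fin q → ℂ))
    (hFdef : ∀ y z, F (y, z) = (Θ y, R y z))
    (hndF : ∀ p, F p = 0 → p = 0)
    (hndΘ : ∀ y, Θ y = 0 → y = 0)
    (GF : (Fin (r + 1) → ℂ) × (Fin q → ℂ) → ℝ)
    (hGF : ∀ p : (Fin (r + 1) → ℂ) × (Fin q → ℂ), p ≠ 0 →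
      Filter.Tendsto (fun n : ℕ => Real.log ‖F^[n] p‖ / (d : ℝ) ^ n)
        Filter.atTop (nhds (GF p)))
    (GΘ : (Fin (r + 1) → ℂ) → ℝ)
    (hGΘ : ∀ y : Fin (r + 1) → ℂ, y ≠ 0 →
      Filter.Tendsto (fun n : ℕ => Real.log ‖Θ^[n] y‖ / (d : ℝ) ^ n)
        Filter.atTop (nhds (GΘ y))) :
    ContinuousOn (fun p : (Fin (r + 1) → ℂ) × (Fin q → ℂ) => GF p - GΘ p.1)
      {p : (Fin (r + 1) → ℂ) × (Fin q → ℂ) | ‖p‖ = 1 ∧ p.1 ≠ 0} ∧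
    ∀ A : ℝ, 0 < A → ∃ δ : ℝ, 0 < δ ∧
      ∀ p : (Fin (r + 1) → ℂ) × (Fin q → ℂ), ‖p‖ = 1 →
        0 < ‖p.1‖ → ‖p.1‖ < δ → A ≤ GF p - GΘ p.1 := by
  obtain ⟨⟨pΘ, hpΘ, hΘ⟩, pR, hpR, hR⟩ := hfib
  have hΘc : Continuous Θ := continuous_pi fun i => by
    simpa only [hΘ] using (pΘ i).continuous_eval
  have hΘh : ∀ (c : ℂ) y, Θ (c • y) = c ^ d • Θ y := fun c y => by
    ext i
    simp only [hΘ, Pi.smul_apply, smul_eq_mul, (hpΘ i).eval_const_smul]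
  have hFeq : ∀ p, F p = (Θ p.1, R p.1 p.2) := fun p => hFdef p.1 p.2
  have helim : Continuous fun p : (Fin (r + 1) → ℂ) × (Fin q → ℂ) =>
      (Sum.elim p.1 p.2 : Fin (r + 1) ⊕ Fin q → ℂ) := continuous_pi fun i => by
    cases i <;> simp only [Sum.elim_inl, Sum.elim_inr] <;> fun_prop
  have hRc : Continuous fun p : (Fin (r + 1) → ℂ) × (Fin q → ℂ) => R p.1 p.2 :=
    continuous_pi fun i => by
      simpa only [hR, Function.comp_def] using (pR i).continuous_eval.comp helim
  have hFc : Continuous F := by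
    rw [funext hFeq]
    exact (hΘc.comp continuous_fst).prodMk hRc
  have hFh : ∀ (c : ℂ) p, F (c • p) = c ^ d • F p := fun c p => by
    have helim_smul : (Sum.elim (c • p.1) (c • p.2) : Fin (r + 1) ⊕ Fin q → ℂ) =
        c • Sum.elim p.1 p.2 := by
      ext i
      cases i <;> rfl
    rw [hFeq, hFeq, Prod.smul_fst, Prod.smul_snd, Prod.smul_mk, hΘh]
    congr 1
    ext i
    simp only [hR, Pi.smul_apply, smul_eq_mul, helim_smul, (hpR i).eval_const_smul]
  obtain ⟨hGFc, C₁, hC₁⟩ := continuousOn_green_and_exists_bound hd hFc hFh hndF hGF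
  obtain ⟨hGΘc, C₂, hC₂⟩ := continuousOn_green_and_exists_bound hd hΘc hΘh hndΘ hGΘ
  refine ⟨(hGFc.mono ?_).sub (hGΘc.comp continuous_fst.continuousOn fun p hp => hp.2), ?_⟩
  · rintro p ⟨-, hp⟩ rfl
    exact hp rfl
  · intro A _
    refine ⟨Real.exp (-(A + C₁ + C₂)), Real.exp_pos _, fun p hp hpos hlt => ?_⟩
    have hp0 : p ≠ 0 := by
      rintro rfl
      simp at hp
    have h₁ := abs_le.mp (hC₁ p hp0)
    have h₂ := abs_le.mp (hC₂ p.1 (norm_pos_iff.mp hpos))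
    have hlog := (Real.log_lt_iff_lt_exp hpos).mpr hlt
    rw [hp, Real.log_one] at h₁
    linarith [h₁.2, h₂.1]
end

section
/- Let $F(y,z)=(\Theta(y),R(y,z))$ be a non-degenerate fibered map of degree $d\ge2$ on $\mathbb{C}^{r+1}\times\mathbb{C}^q$ with $\Theta$ non-degenerate, and let $A\in\mathbb{C}^{r+1}\setminus\{0\}$ satisfy $\Theta^n(A)=A$ for some $n\ge1$. With $R_n:=R_{\Theta^{n-1}(A)}\circ\cdots\circ R_A$ (where $R_B(Z):=R(B,Z)$), one has for every $Z\in\mathbb{C}^q$: $G_F(A,Z)=\lim_{l\to\infty}d^{-ln}\max\big(\log\|R_n^{\circ l}(Z)\|_\infty,\,0\big)$. Since $G_\Theta(A)=0$, the relative Green function $G=G_F-G_\Theta\circ\mathrm{pr}_y$ restricted to the fiber over the periodic point $[A]$ is exactly the Green function of the regular polynomial endomorphism $R_n$ of $\mathbb{C}^q$. -/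
/-- `fiberComp Θ R A n = R_{Θ^{n-1}(A)} ∘ ⋯ ∘ R_{Θ(A)} ∘ R_A` where `R_B(Z) = R(B,Z)`. -/
def fiberComp {r q : ℕ} (Θ : (Fin (r + 1) → ℂ) → (Fin (r + 1) → ℂ))
    (R : (Fin (r + 1) → ℂ) → (Fin q → ℂ) → (Fin q → ℂ))
    (A : Fin (r + 1) → ℂ) : ℕ → (Fin q → ℂ) → (Fin q → ℂ)
  | 0 => id
  | m + 1 => fun Z => R (Θ^[m] A) (fiberComp Θ R A m Z)

/-- Iterates of a fibered map act on the base by iterates of `Θ` and on fibers by `fiberComp`. -/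
theorem iterate_fibered {r q : ℕ} {Θ : (Fin (r + 1) → ℂ) → (Fin (r + 1) → ℂ)}
    {R : (Fin (r + 1) → ℂ) → (Fin q → ℂ) → (Fin q → ℂ)}
    {F : (Fin (r + 1) → ℂ) × (Fin q → ℂ) → (Fin (r + 1) → ℂ) × (Fin q → ℂ)}
    (hF : ∀ y z, F (y, z) = (Θ y, R y z)) (y : Fin (r + 1) → ℂ) (z : Fin q → ℂ) (m : ℕ) :
    F^[m] (y, z) = (Θ^[m] y, fiberComp Θ R y m z) := by
  induction m with
  | zero => rfl
  | succ m ih => rw [Function.iterate_succ_apply', ih, hF, Function.iterate_succ_apply']; rfl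

/-- Over a periodic base point, iterates along multiples of the period stay in the fiber. -/
theorem iterate_mul_fibered_of_periodic {r q : ℕ} {Θ : (Fin (r + 1) → ℂ) → (Fin (r + 1) → ℂ)}
    {R : (Fin (r + 1) → ℂ) → (Fin q → ℂ) → (Fin q → ℂ)}
    {F : (Fin (r + 1) → ℂ) × (Fin q → ℂ) → (Fin (r + 1) → ℂ) × (Fin q → ℂ)}
    (hF : ∀ y z, F (y, z) = (Θ y, R y z)) {A : Fin (r + 1) → ℂ} {n : ℕ}
    (hper : Θ^[n] A = A) (z : Fin q → ℂ) (l : ℕ) :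
    F^[l * n] (A, z) = (A, (fiberComp Θ R A n)^[l] z) := by
  induction l with
  | zero => simp
  | succ l ih =>
    rw [Nat.succ_mul, Nat.add_comm (l * n) n, Function.iterate_add_apply, ih, iterate_fibered hF, hper,
      Function.iterate_succ_apply']

theorem abs_max_log_sub_log_max_le {a x : ℝ} (ha : 0 < a) (hx : 0 ≤ x) :
    |max (Real.log x) 0 - Real.log (max a x)| ≤ |Real.log a| := by
  rcases hx.eq_or_lt with rfl | hx
  · simp [max_eq_left ha.le]
  · have h : Real.log (max a x) = max (Real.log x) (Real.log a) := by
      rcases le_total a x with hax | hax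
      · rw [max_eq_right hax, max_eq_left (Real.log_le_log ha hax)]
      · rw [max_eq_left hax, max_eq_right (Real.log_le_log hx hax)]
    rw [h]
    simpa using abs_max_sub_max_le_max (Real.log x) 0 (Real.log x) (Real.log a)

/-- for a non-degenerate fibered map `F(y,z) = (Θ(y), R(y,z))` of degree
`d ≥ 2` with `Θ` non-degenerate, and `A ≠ 0` with `Θ^n(A) = A`, `n ≥ 1`, setting
`R_n := R_{Θ^{n-1}(A)} ∘ ⋯ ∘ R_A`, one has for every `Z ∈ ℂ^q`
`G_F(A,Z) = lim_{l → ∞} d^{-ln} max(log ‖R_n^l(Z)‖, 0)`, i.e. the relative Green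
function restricted to the fiber over the periodic point `[A]` is the Green function of
the regular polynomial endomorphism `R_n` of `ℂ^q`. -/
theorem stmt13 (r q d : ℕ) (hd : 2 ≤ d)
    (Θ : (Fin (r + 1) → ℂ) → (Fin (r + 1) → ℂ))
    (R : (Fin (r + 1) → ℂ) → (Fin q → ℂ) → (Fin q → ℂ))
    (hfib : IsFiberedMap r q d Θ R)
    (F : (Fin (r + 1) → ℂ) × (Fin q → ℂ) → (Fin (r + 1) → ℂ) × (Fin q → ℂ))
    (hFdef : ∀ y z, F (y, z) = (Θ y, R y z))
    (hndF : ∀ p, F p = 0 → p = 0)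
    (hndΘ : ∀ y, Θ y = 0 → y = 0)
    (GF : (Fin (r + 1) → ℂ) × (Fin q → ℂ) → ℝ)
    (hGF : ∀ p : (Fin (r + 1) → ℂ) × (Fin q → ℂ), p ≠ 0 →
      Filter.Tendsto (fun m : ℕ => Real.log ‖F^[m] p‖ / (d : ℝ) ^ m)
        Filter.atTop (nhds (GF p)))
    (A : Fin (r + 1) → ℂ) (hA : A ≠ 0)
    (n : ℕ) (hn : 1 ≤ n) (hper : Θ^[n] A = A) :
    ∀ Z : Fin q → ℂ,
      Filter.Tendsto
        (fun l : ℕ =>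
          max (Real.log ‖(fiberComp Θ R A n)^[l] Z‖) 0 / (d : ℝ) ^ (l * n))
        Filter.atTop (nhds (GF (A, Z))) := by
  intro Z
  have hd1 : (1 : ℝ) < d := by exact_mod_cast hd
  have hmul : Filter.Tendsto (fun l : ℕ => l * n) Filter.atTop Filter.atTop :=
    Filter.tendsto_id.atTop_mul_const' hn
  have hlim := (hGF (A, Z) fun h => hA (congrArg Prod.fst h)).comp hmul
  have hzero : Filter.Tendsto (fun l : ℕ => |Real.log ‖A‖| / (d : ℝ) ^ (l * n))
      Filter.atTop (nhds 0) :=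
    ((tendsto_pow_atTop_atTop_of_one_lt hd1).comp hmul).const_div_atTop _
  have hdiff : Filter.Tendsto (fun l : ℕ =>
      max (Real.log ‖(fiberComp Θ R A n)^[l] Z‖) 0 / (d : ℝ) ^ (l * n)
        - Real.log ‖F^[l * n] (A, Z)‖ / (d : ℝ) ^ (l * n)) Filter.atTop (nhds 0) := by
    refine squeeze_zero_norm (fun l => ?_) hzero
    have hpos : (0 : ℝ) < (d : ℝ) ^ (l * n) := pow_pos (zero_lt_one.trans hd1) _
    rw [← sub_div, Real.norm_eq_abs, abs_div, abs_of_pos hpos,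
      iterate_mul_fibered_of_periodic hFdef hper, Prod.norm_mk]
    exact div_le_div_of_nonneg_right
      (abs_max_log_sub_log_max_le (norm_pos_iff.mpr hA) (norm_nonneg _)) hpos.le
  simpa using hdiff.add hlim
end
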